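/- Let N, R ≥ 1 be natural numbers. For each n ∈ {1,…,N} and r, m ∈ {1,…,R}, let a_{n,m} ∈ ℝ^{P_in} be vectors and b_{n,r,m} ∈ ℝ^{P_out×C}, Λ_{n,r} ∈ ℝ^{C×C} real matrices. Assume b_{n,r,m} = 0 whenever r ≠ m. Then both the exact layer GGN and the cross-term-dropped approximation collapse to the same diagonal expression: Σ_{n=1}^N Σ_{r=1}^R (Σ_{m=1}^R a_{n,m} ⊗ b_{n,r,m}) · Λ_{n,r} · (Σ_{m'=1}^R a_{n,m'} ⊗ b_{n,r,m'})ᵀ = Σ_{n=1}^N Σ_{r=1}^R Σ_{m=1}^R (a_{n,m} ⊗ b_{n,r,m}) · Λ_{n,r} · (a_{n,m} ⊗ b_{n,r,m})ᵀ = Σ_{n=1}^N Σ_{r=1}^R (a_{n,r} a_{n,r}ᵀ) ⊗ (b_{n,r,r} · Λ_{n,r} · b_{n,r,r}ᵀ). -/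

import Mathlib

open Matrix Kronecker

/-- Kronecker product of a column vector `a ∈ ℝ^p` (identified with a `p × 1`
column matrix) with an `s × t` matrix `B`, yielding a `(p·s) × t` matrix. -/
def vecKron {p s t : ℕ} (a : Fin p → ℝ) (B : Matrix (Fin s) (Fin t) ℝ) :
    Matrix (Fin p × Fin s) (Fin t) ℝ :=
  Matrix.of fun q k => a q.1 * B q.2 k

/-- The sandwiched product of vector Kronecker products is a Kronecker product of the factors. -/
theorem vecKron_mul_mul_transpose {p s t : ℕ} (a : Fin p → ℝ) (B : Matrix (Fin s) (Fin t) ℝ)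
    (L : Matrix (Fin t) (Fin t) ℝ) :
    vecKron a B * L * (vecKron a B)ᵀ = vecMulVec a a ⊗ₖ (B * L * Bᵀ) := by
  ext i j
  simp only [vecKron, mul_apply, transpose_apply, of_apply, kroneckerMap_apply, vecMulVec_apply,
    Finset.mul_sum, Finset.sum_mul]
  refine Finset.sum_congr rfl fun x _ => Finset.sum_congr rfl fun y _ => ?_
  ring

theorem vecKron_zero {p s t : ℕ} (a : Fin p → ℝ) :
    vecKron a (0 : Matrix (Fin s) (Fin t) ℝ) = 0 := by
  ext i j
  simp [vecKron]

/-- When the cross pre-activation Jacobians vanish (`b n r m = 0` for `r ≠ m`),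
the exact layer GGN and the cross-term-dropped approximation both collapse to
the same diagonal expression. -/
theorem kfac_expand_cross_terms_vanish
    (N R Pin Pout C : ℕ) (hN : 1 ≤ N) (hR : 1 ≤ R)
    (a : Fin N → Fin R → (Fin Pin → ℝ))
    (b : Fin N → Fin R → Fin R → Matrix (Fin Pout) (Fin C) ℝ)
    (Λ : Fin N → Fin R → Matrix (Fin C) (Fin C) ℝ)
    (hb : ∀ n r m, r ≠ m → b n r m = 0) :
    (∑ n, ∑ r, (∑ m, vecKron (a n m) (b n r m)) * Λ n r *
        (∑ m', vecKron (a n m') (b n r m'))ᵀ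
      = ∑ n, ∑ r, ∑ m, vecKron (a n m) (b n r m) * Λ n r *
          (vecKron (a n m) (b n r m))ᵀ) ∧
    (∑ n, ∑ r, ∑ m, vecKron (a n m) (b n r m) * Λ n r *
        (vecKron (a n m) (b n r m))ᵀ
      = ∑ n, ∑ r, vecMulVec (a n r) (a n r) ⊗ₖ (b n r r * Λ n r * (b n r r)ᵀ)) := by
  have hzero : ∀ n r m, m ≠ r → vecKron (a n m) (b n r m) = 0 := fun n r m h => by
    rw [hb n r m h.symm, vecKron_zero]
  have hsum : ∀ n r, ∑ m, vecKron (a n m) (b n r m) = vecKron (a n r) (b n r r) := fun n r =>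
    Fintype.sum_eq_single r fun m h => hzero n r m h
  have hdiag : ∀ n r, ∑ m, vecKron (a n m) (b n r m) * Λ n r * (vecKron (a n m) (b n r m))ᵀ
      = vecKron (a n r) (b n r r) * Λ n r * (vecKron (a n r) (b n r r))ᵀ := fun n r =>
    Fintype.sum_eq_single r fun m h => by simp [hzero n r m h]
  simp only [hsum, hdiag]
  simp only [vecKron_mul_mul_transpose, and_self]
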